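/- arXiv:2505.02723 — 2 statements merged into one kernel-verified Lean document; each statement's English description precedes it below -/
import Mathlib

section
/- Fix K, ℓ, β, δ > 0 with 1 − δ/2 < e^{−β}. There exists a constant M = M(K, ℓ, β, δ) such that every analytic function h(z) = Σ_k h_k z^k on the unit disk satisfying |h_k| ≤ K e^{βk} for all k, and satisfying max_{0≤j≤ℓ} |h_j| ≥ c₀ for a fixed c₀ > 0, has at most M zeros (counted with multiplicity) in the disk {|z| ≤ 1−δ}. -/
open scoped Nat

/-- Division of a zero of order at least `n` at a point of the unit disk. -/
lemma factor_one (f : ℂ → ℂ) (hf : AnalyticOnNhd ℂ f (Metric.ball 0 1)) (a : ℂ)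
    (ha : a ∈ Metric.ball (0 : ℂ) 1) (n : ℕ) (hn : (n : ℕ∞) ≤ analyticOrderAt f a) :
    ∃ g : ℂ → ℂ, AnalyticOnNhd ℂ g (Metric.ball 0 1) ∧ ∀ z, z ∈ Metric.ball (0 : ℂ) 1 →
      f z = (z - a) ^ n * g z := by
  classical
  obtain ⟨g₀, hg₀, he⟩ := (natCast_le_analyticOrderAt (hf a ha)).1 hn
  refine ⟨fun z => if z = a then g₀ a else f z / (z - a) ^ n, ?_, ?_⟩
  · intro z hz
    by_cases hza : z = a
    · subst hza
      refine hg₀.congr ?_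
      filter_upwards [he] with w hw
      by_cases hwz : w = z
      · simp [hwz]
      · have : (w - z) ^ n ≠ 0 := pow_ne_zero _ (sub_ne_zero.2 hwz)
        simp only [hwz, if_false]
        rw [hw, smul_eq_mul]
        field_simp
    · have h1 : AnalyticAt ℂ (fun w => f w / (w - a) ^ n) z :=
        (hf z hz).div (by fun_prop) (pow_ne_zero _ (sub_ne_zero.2 hza))
      refine h1.congr ?_
      filter_upwards [isOpen_ne.mem_nhds hza] with w hw
      have hw' : w ≠ a := hw
      simp [hw']
  · intro z hz
    by_cases hza : z = a
    · subst hza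
      simpa using he.self_of_nhds
    · have : (z - a) ^ n ≠ 0 := pow_ne_zero _ (sub_ne_zero.2 hza)
      simp only [hza, if_false]
      field_simp

lemma blaschke_id (r : ℝ) (a z : ℂ) :
    ‖(r : ℂ) ^ 2 - (starRingEnd ℂ) a * z‖ ^ 2 - r ^ 2 * ‖z - a‖ ^ 2
      = (r ^ 2 - ‖a‖ ^ 2) * (r ^ 2 - ‖z‖ ^ 2) := by
  simp only [← Complex.normSq_eq_norm_sq, Complex.normSq_apply]
  simp [pow_two]
  ring

lemma blaschke_le (r ρ : ℝ) (hρ : 0 < ρ) (hr : ρ < r) (a z : ℂ) (ha : ‖a‖ ≤ ρ) (hz : ‖z‖ ≤ ρ) :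
    ‖z - a‖ ≤ (2 * r * ρ / (r ^ 2 + ρ ^ 2)) * ‖((r : ℂ) ^ 2 - (starRingEnd ℂ) a * z) / r‖ := by
  have hr0 : 0 < r := hρ.trans hr
  have hid := blaschke_id r a z
  rw [norm_div, Complex.norm_real, Real.norm_eq_abs, abs_of_pos hr0]
  set Y := ‖(r : ℂ) ^ 2 - (starRingEnd ℂ) a * z‖ with hY
  set X := ‖z - a‖ with hX
  have hYle : Y ≤ r ^ 2 + ρ ^ 2 := by
    refine (norm_sub_le _ _).trans ?_
    have : ‖(starRingEnd ℂ) a * z‖ ≤ ρ ^ 2 := by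
      rw [norm_mul, RCLike.norm_conj, pow_two]
      gcongr
    have h2 : ‖(r : ℂ) ^ 2‖ = r ^ 2 := by simp
    linarith
  have hY0 : 0 ≤ Y := norm_nonneg _
  have hX0 : 0 ≤ X := norm_nonneg _
  have ha2 : ‖a‖ ^ 2 ≤ ρ ^ 2 := by gcongr
  have hz2 : ‖z‖ ^ 2 ≤ ρ ^ 2 := by gcongr
  have hrρ : 0 ≤ r ^ 2 - ρ ^ 2 := by nlinarith
  have h1 : (r ^ 2 - ρ ^ 2) ^ 2 ≤ (r ^ 2 - ‖a‖ ^ 2) * (r ^ 2 - ‖z‖ ^ 2) := by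
    rw [pow_two]
    apply mul_le_mul <;> linarith
  have hY2 : Y ^ 2 ≤ (r ^ 2 + ρ ^ 2) ^ 2 := by gcongr
  have key : (r * X * (r ^ 2 + ρ ^ 2)) ^ 2 ≤ (2 * r * ρ * Y) ^ 2 := by
    have e1 : r ^ 2 * X ^ 2 ≤ Y ^ 2 - (r ^ 2 - ρ ^ 2) ^ 2 := by linarith
    have e2 := mul_le_mul_of_nonneg_right e1 (sq_nonneg (r ^ 2 + ρ ^ 2))
    have e3 := mul_le_mul_of_nonneg_left hY2 (sq_nonneg (r ^ 2 - ρ ^ 2))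
    nlinarith
  have key2 : r * X * (r ^ 2 + ρ ^ 2) ≤ 2 * r * ρ * Y :=
    le_of_sq_le_sq key (by positivity)
  rw [div_mul_div_comm, le_div_iff₀ (by positivity)]
  linarith

lemma blaschke_eq (r : ℝ) (hr : 0 < r) (a z : ℂ) (hz : ‖z‖ = r) :
    ‖((r : ℂ) ^ 2 - (starRingEnd ℂ) a * z) / r‖ = ‖z - a‖ := by
  have hid := blaschke_id r a z
  rw [norm_div, Complex.norm_real, Real.norm_eq_abs, abs_of_pos hr, div_eq_iff hr.ne']
  rw [hz, sub_self, mul_zero, sub_eq_zero, ← mul_pow] at hid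
  rw [mul_comm ‖z - a‖ r]
  exact (pow_left_inj₀ (norm_nonneg _) (by positivity) two_ne_zero).1 hid

lemma diffCont (r : ℝ) (hr0 : 0 < r) (hr1 : r < 1) (f : ℂ → ℂ)
    (hf : AnalyticOnNhd ℂ f (Metric.ball 0 1)) : DiffContOnCl ℂ f (Metric.ball 0 r) := by
  apply DifferentiableOn.diffContOnCl
  rw [closure_ball _ hr0.ne']
  exact hf.differentiableOn.mono (Metric.closedBall_subset_ball hr1)

lemma blaschke_bound (r ρ B : ℝ) (hρ : 0 < ρ) (hr : ρ < r) (hr1 : r < 1)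
    (ord : ℂ → ℕ) (S : Finset ℂ) : ∀ f : ℂ → ℂ, AnalyticOnNhd ℂ f (Metric.ball 0 1) →
      (∀ a ∈ S, ‖a‖ ≤ ρ) → (∀ a ∈ S, (ord a : ℕ∞) ≤ analyticOrderAt f a) →
      (∀ z, ‖z‖ = r → ‖f z‖ ≤ B) → ∀ z, ‖z‖ ≤ ρ →
      ‖f z‖ ≤ B * (2 * r * ρ / (r ^ 2 + ρ ^ 2)) ^ (∑ a ∈ S, ord a) := by
  classical
  have hr0 : 0 < r := hρ.trans hr
  induction S using Finset.induction_on with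
  | empty =>
    intro f hf _ _ hB z hz
    simp only [Finset.sum_empty, pow_zero, mul_one]
    refine Complex.norm_le_of_forall_mem_frontier_norm_le (U := Metric.ball 0 r)
      Metric.isBounded_ball (diffCont r hr0 hr1 f hf) ?_ ?_
    · intro w hw
      rw [frontier_ball _ hr0.ne'] at hw
      exact hB w (by simpa using hw)
    · rw [closure_ball _ hr0.ne']
      simpa using hz.trans hr.le
  | insert a S haS ih =>
    intro f hf hS hord hB z hz
    have haρ : ‖a‖ ≤ ρ := hS a (by simp)
    have mem : ∀ w : ℂ, ‖w‖ ≤ r → w ∈ Metric.ball (0 : ℂ) 1 := fun w hw => by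
      simpa using hw.trans_lt hr1
    obtain ⟨g, hg, hfg⟩ := factor_one f hf a (mem a (haρ.trans hr.le)) (ord a)
      (hord a (by simp))
    set F : ℂ → ℂ := fun w => (((r : ℂ) ^ 2 - (starRingEnd ℂ) a * w) / r) ^ (ord a) * g w with hF
    have hFan : AnalyticOnNhd ℂ F (Metric.ball 0 1) := by
      intro w hw
      have h1 : AnalyticAt ℂ
          (fun w : ℂ => (((r : ℂ) ^ 2 - (starRingEnd ℂ) a * w) / r) ^ (ord a)) w := by
        have : (r : ℂ) ≠ 0 := by exact_mod_cast hr0.ne'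
        fun_prop (disch := assumption)
      exact h1.mul (hg w hw)
    have hFord : ∀ b ∈ S, (ord b : ℕ∞) ≤ analyticOrderAt F b := by
      intro b hb
      have hbm := mem b ((hS b (by simp [hb])).trans hr.le)
      have hba : b ≠ a := fun h => haS (h ▸ hb)
      have h1 := hord b (by simp [hb])
      rw [natCast_le_analyticOrderAt (hFan b hbm)]
      obtain ⟨k, hk, hke⟩ := (natCast_le_analyticOrderAt (hf b hbm)).1 h1
      have hne : (b - a) ^ ord a ≠ 0 := pow_ne_zero _ (sub_ne_zero.2 hba)
      refine ⟨fun w => (((r : ℂ) ^ 2 - (starRingEnd ℂ) a * w) / r) ^ (ord a) *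
        (k w / (w - a) ^ ord a), ?_, ?_⟩
      · have h1 : AnalyticAt ℂ
            (fun w : ℂ => (((r : ℂ) ^ 2 - (starRingEnd ℂ) a * w) / r) ^ (ord a)) b := by
          have : (r : ℂ) ≠ 0 := by exact_mod_cast hr0.ne'
          fun_prop (disch := assumption)
        exact h1.mul (hk.div (by fun_prop) hne)
      · filter_upwards [hke, isOpen_ne.mem_nhds hba, Metric.isOpen_ball.mem_nhds hbm]
          with w hw hwa hwm
        have hne' : (w - a) ^ ord a ≠ 0 := pow_ne_zero _ (sub_ne_zero.2 hwa)
        have hgw : g w = (w - b) ^ ord b * (k w / (w - a) ^ ord a) := by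
          have := hfg w hwm
          rw [hw, smul_eq_mul] at this
          rw [← mul_div_assoc, this]
          field_simp
        simp only [hF, hgw, smul_eq_mul]
        ring
    have hFB : ∀ w, ‖w‖ = r → ‖F w‖ ≤ B := by
      intro w hw
      have := hB w hw
      rw [hfg w (mem w hw.le), norm_mul, norm_pow] at this
      simp only [hF]
      rw [norm_mul, norm_pow, blaschke_eq r hr0 a w hw]
      exact this
    have hz' := ih F hFan (fun b hb => hS b (by simp [hb])) hFord hFB z hz
    set q := 2 * r * ρ / (r ^ 2 + ρ ^ 2) with hq
    have hq0 : 0 ≤ q := by positivity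
    rw [Finset.sum_insert haS, hfg z (mem z (hz.trans hr.le)), norm_mul, norm_pow]
    calc ‖z - a‖ ^ ord a * ‖g z‖
        ≤ (q * ‖((r : ℂ) ^ 2 - (starRingEnd ℂ) a * z) / r‖) ^ ord a * ‖g z‖ := by
          gcongr
          exact blaschke_le r ρ hρ hr a z haρ hz
      _ = q ^ ord a * ‖F z‖ := by
          simp only [hF]
          rw [norm_mul, norm_pow, mul_pow]
          ring
      _ ≤ q ^ ord a * (B * q ^ (∑ x ∈ S, ord x)) := by gcongr
      _ = _ := by rw [pow_add]; ring

lemma taylor_bound (K β r : ℝ) (hr0 : 0 < r) (hr1 : r < 1)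
    (hrβ : r < Real.exp (-β)) (h : ℂ → ℂ) (hh : AnalyticOnNhd ℂ h (Metric.ball 0 1))
    (hc : ∀ k : ℕ, ‖iteratedDeriv k h 0 / (k ! : ℂ)‖ ≤ K * Real.exp (β * k))
    (z : ℂ) (hz : ‖z‖ = r) : ‖h z‖ ≤ K * (1 - Real.exp β * r)⁻¹ := by
  have hlt : Real.exp β * r < 1 := by
    calc Real.exp β * r < Real.exp β * Real.exp (-β) := by gcongr
      _ = 1 := by rw [← Real.exp_add]; simp
  have hs := Complex.hasSum_taylorSeries_on_ball hh.differentiableOn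
    (z := z) (by simpa [hz] using hr1)
  have hgeo := (hasSum_geometric_of_lt_one (by positivity) hlt).mul_left K
  rw [← hs.tsum_eq]
  refine tsum_of_norm_bounded hgeo fun k => ?_
  have e : (k ! : ℂ)⁻¹ • (z - 0) ^ k • iteratedDeriv k h 0
      = z ^ k * (iteratedDeriv k h 0 / (k ! : ℂ)) := by
    simp only [smul_eq_mul, sub_zero]
    ring
  rw [e, norm_mul, norm_pow, hz]
  calc r ^ k * ‖iteratedDeriv k h 0 / (k ! : ℂ)‖ ≤ r ^ k * (K * Real.exp (β * k)) := by
        gcongr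
        exact hc k
    _ = K * (Real.exp β * r) ^ k := by
        rw [mul_pow, ← Real.exp_nat_mul, mul_comm (k : ℝ) β]
        ring



/-- Every analytic function on the unit disk with Taylor coefficients bounded by
`K e^{βk}` and with some early coefficient of modulus at least `c₀` has at most `M`
zeros, counted with multiplicity, in the disk `{|z| ≤ 1−δ}`, where
`M = M(K, ℓ, β, δ, c₀)`. -/
theorem stmt_3 (K β δ c₀ : ℝ) (ℓ : ℕ) (hK : 0 < K) (hβ : 0 < β) (hδ : 0 < δ)
    (hδ1 : δ < 1) (hc₀ : 0 < c₀) (hδβ : 1 - δ / 2 < Real.exp (-β)) :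
    ∃ M : ℕ, ∀ h : ℂ → ℂ, AnalyticOnNhd ℂ h (Metric.ball 0 1) →
      (∀ k : ℕ, ‖iteratedDeriv k h 0 / (k ! : ℂ)‖ ≤ K * Real.exp (β * k)) →
      (∃ j ≤ ℓ, c₀ ≤ ‖iteratedDeriv j h 0 / (j ! : ℂ)‖) →
      ∀ (S : Finset ℂ) (ord : ℂ → ℕ),
        (∀ z ∈ S, ‖z‖ ≤ 1 - δ) →
        (∀ z ∈ S, 1 ≤ ord z ∧ ∀ j < ord z, iteratedDeriv j h z = 0) →
        ∑ z ∈ S, ord z ≤ M := by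
  set r : ℝ := 1 - δ / 2 with hrdef
  set ρ : ℝ := 1 - δ with hρdef
  have hρ : 0 < ρ := by linarith
  have hr : ρ < r := by linarith
  have hr1 : r < 1 := by linarith
  have hr0 : 0 < r := hρ.trans hr
  have hρ1 : ρ ≤ 1 := by linarith
  set q : ℝ := 2 * r * ρ / (r ^ 2 + ρ ^ 2) with hq
  have hq0 : 0 ≤ q := by positivity
  have hq1 : q < 1 := by
    rw [hq, div_lt_one (by positivity)]
    nlinarith [sq_pos_of_pos (sub_pos.2 hr)]
  have hlt : Real.exp β * r < 1 := by
    calc Real.exp β * r < Real.exp β * Real.exp (-β) := by gcongr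
      _ = 1 := by rw [← Real.exp_add]; simp
  set B : ℝ := K * (1 - Real.exp β * r)⁻¹ with hBdef
  have hB : 0 < B := mul_pos hK (inv_pos.2 (by linarith))
  obtain ⟨M, hM⟩ := exists_pow_lt_of_lt_one (show 0 < c₀ * ρ ^ ℓ / B by positivity) hq1
  refine ⟨M, fun h hh hc hj S ord hS hord => ?_⟩
  by_contra! hcon
  obtain ⟨j, hjl, hj⟩ := hj
  have mem : ∀ w : ℂ, ‖w‖ ≤ r → w ∈ Metric.ball (0 : ℂ) 1 := fun w hw => by
    simpa using hw.trans_lt hr1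
  have hbd := blaschke_bound r ρ B hρ hr hr1 ord S h hh hS
    (fun a ha => (natCast_le_analyticOrderAt_iff_iteratedDeriv_eq_zero
      (hh a (mem a ((hS a ha).trans hr.le)))).2 (hord a ha).2)
    (fun z hz => taylor_bound K β r hr0 hr1 hδβ h hh hc z hz)
  have hcau := Complex.norm_iteratedDeriv_le_of_forall_mem_sphere_norm_le j hρ
    (diffCont ρ hρ (hr.trans hr1) h hh) (fun z hz => hbd z (by simpa using (mem_sphere_zero_iff_norm.1 hz).le))
  have hfac : (0 : ℝ) < (j ! : ℝ) := by positivity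
  rw [norm_div, Complex.norm_natCast, le_div_iff₀ hfac] at hj
  have h1 : c₀ ≤ B * q ^ (∑ a ∈ S, ord a) / ρ ^ j := by
    have := hj.trans hcau
    rw [mul_comm, mul_div_assoc] at this
    exact le_of_mul_le_mul_left this hfac
  rw [le_div_iff₀ (by positivity)] at h1
  have h2 : q ^ (∑ a ∈ S, ord a) ≤ q ^ M := pow_le_pow_of_le_one hq0 hq1.le hcon.le
  have h3 : ρ ^ ℓ ≤ ρ ^ j := pow_le_pow_of_le_one hρ.le hρ1 hjl
  rw [lt_div_iff₀ hB] at hM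
  have h4 : B * q ^ (∑ a ∈ S, ord a) ≤ q ^ M * B := by
    rw [mul_comm]; gcongr
  have h5 : c₀ * ρ ^ ℓ ≤ c₀ * ρ ^ j := by gcongr
  linarith
end

section
/- Let β ∈ (0,1), K > 0, and let h(z) = Σ_{k≥0} h_k z^k be analytic on 𝔻 with |h_k| ≤ K e^{βk} for all k; let p_m be its m-th Taylor polynomial at 0. For each γ > 0 there exists C = C(γ, K, β) such that: if h(z₀) = h′(z₀) = 0 and |h″(z₀)| ≥ γ for some z₀ in the annulus {β < |z| < e^{−8β}}, then for every m ≥ C there exists w in the annulus {β e^{−β} < |z| < e^{−7β}} with p_m′(w) = 0 and |h(w)| ≤ C e^{−βm} |w|^m. -/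
open scoped Nat

open Metric in
lemma aux_cauchy {f : ℂ → ℂ} {c : ℂ} {R R' s M : ℝ} (hs : 0 < s) (hR : R + s ≤ R')
    (hf : AnalyticOnNhd ℂ f (closedBall c R')) (hM : ∀ z ∈ closedBall c R', ‖f z‖ ≤ M) :
    ∀ z ∈ closedBall c R, ‖deriv f z‖ ≤ M / s := by
  intro z hz
  have hsub : closedBall z s ⊆ closedBall c R' := by
    apply closedBall_subset_closedBall'
    rw [mem_closedBall] at hz
    linarith
  apply Complex.norm_deriv_le_of_forall_mem_sphere_norm_le hs
  · exact DifferentiableOn.diffContOnCl_ball (U := closedBall c R') hf.differentiableOn hsub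
  · intro w hw
    exact hM w (hsub (sphere_subset_closedBall hw))

lemma aux_tail {h : ℂ → ℂ} {K x ρ : ℝ} (hK : 0 < K) (hx : 0 < x) (hρ : 0 ≤ ρ) (hρ1 : ρ < 1)
    (hxρ : x * ρ < 1)
    (hh : AnalyticOnNhd ℂ h (Metric.ball 0 1))
    (hb : ∀ k : ℕ, ‖iteratedDeriv k h 0 / (k ! : ℂ)‖ ≤ K * x ^ k) (N : ℕ) (z : ℂ)
    (hz : ‖z‖ ≤ ρ) :
    ‖h z - ∑ k ∈ Finset.range N, (iteratedDeriv k h 0 / (k ! : ℂ)) * z ^ k‖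
      ≤ K / (1 - x * ρ) * (x * ρ) ^ N := by
  have h1 := Complex.hasSum_taylorSeries_on_ball (f := h) (c := 0) (r := 1) (z := z)
    (by simpa using hh.differentiableOn) (by simpa using lt_of_le_of_lt hz hρ1)
  have h2 : HasSum (fun k : ℕ => (iteratedDeriv k h 0 / (k ! : ℂ)) * z ^ k) (h z) := by
    have e : (fun k : ℕ => (iteratedDeriv k h 0 / (k ! : ℂ)) * z ^ k) =
        fun k : ℕ => (k ! : ℂ)⁻¹ • (z - 0) ^ k • iteratedDeriv k h 0 := by
      funext k
      rw [sub_zero, smul_eq_mul, smul_eq_mul]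
      ring
    rw [e]
    exact h1
  have h3 := (hasSum_nat_add_iff' N).2 h2
  have h4 := (hasSum_geometric_of_lt_one (by positivity) hxρ).mul_left (K * (x * ρ) ^ N)
  have h5 := h3.norm_le_of_bounded h4 (fun k => ?_)
  · refine h5.trans (le_of_eq ?_)
    rw [div_eq_mul_inv]; ring
  · rw [norm_mul, norm_pow]
    calc _ ≤ (K * x ^ (k + N)) * ρ ^ (k + N) := by
          gcongr
          exact hb _
      _ = _ := by ring

open Metric in
/-- quantitative Rouché-type statement -/
lemma aux_core {h p : ℂ → ℂ} {c : ℂ} {s H Q γ δ : ℝ} (hs : 0 < s)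
    (hδ : 0 < δ) (hδs : δ ≤ s)
    (hh : AnalyticOnNhd ℂ h (closedBall c (4 * s)))
    (hp : AnalyticOnNhd ℂ p (closedBall c (4 * s)))
    (hH : ∀ z ∈ closedBall c (4 * s), ‖h z‖ ≤ H)
    (hQ : ∀ z ∈ closedBall c (4 * s), ‖h z - p z‖ ≤ Q)
    (h0 : h c = 0) (h1 : deriv h c = 0) (h2 : γ ≤ ‖deriv (deriv h) c‖)
    (hδ1 : H / s / s / s * δ ≤ γ / 2) (hδ2 : 4 * (Q / s) < γ * δ / 2) :
    ∃ w ∈ closedBall c δ, deriv p w = 0 ∧ ‖h w‖ ≤ H / s / s * δ * δ := by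
  have mono : ∀ {a b : ℝ}, a ≤ b → closedBall c a ⊆ closedBall c b :=
    fun hab => closedBall_subset_closedBall hab
  have hcs : ∀ {a : ℝ}, 0 ≤ a → c ∈ closedBall c a := fun ha => mem_closedBall_self ha
  have d1 := aux_cauchy (R := 3 * s) hs (by linarith) hh hH
  have d2 := aux_cauchy (R := 2 * s) (R' := 3 * s) hs (by linarith)
    (hh.deriv.mono (mono (by linarith))) d1
  have d3 := aux_cauchy (R := s) (R' := 2 * s) hs (by linarith)
    (hh.deriv.deriv.mono (mono (by linarith))) d2
  have e1 := aux_cauchy (R := 3 * s) hs (by linarith) (hh.sub hp) hQ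
  have e1' : ∀ z ∈ closedBall c δ, ‖deriv h z - deriv p z‖ ≤ Q / s := by
    intro z hz
    have := e1 z (mono (by linarith) hz)
    have hz4 : z ∈ closedBall c (4 * s) := mono (by linarith) hz
    rwa [deriv_sub (hh z hz4).differentiableAt (hp z hz4).differentiableAt] at this
  have hM2 : 0 ≤ H / s / s := (norm_nonneg _).trans (d2 c (hcs (by linarith)))
  have hM3 : 0 ≤ H / s / s / s := (norm_nonneg _).trans (d3 c (hcs (by linarith)))
  have t1 : ∀ z ∈ closedBall c δ, ‖deriv h z‖ ≤ H / s / s * δ := by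
    intro z hz
    have := (convex_closedBall c δ).norm_image_sub_le_of_norm_deriv_le (f := deriv h)
      (fun u hu => (hh.deriv u (mono (by linarith) hu)).differentiableAt)
      (fun u hu => d2 u (mono (by linarith) hu)) (hcs hδ.le) hz
    rw [h1, sub_zero] at this
    refine this.trans ?_
    gcongr
    simpa [dist_eq_norm] using hz
  have t0 : ∀ z ∈ closedBall c δ, ‖h z‖ ≤ H / s / s * δ * δ := by
    intro z hz
    have := (convex_closedBall c δ).norm_image_sub_le_of_norm_deriv_le (f := h)
      (fun u hu => (hh u (mono (by linarith) hu)).differentiableAt)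
      t1 (hcs hδ.le) hz
    rw [h0, sub_zero] at this
    refine this.trans ?_
    gcongr
    simpa [dist_eq_norm] using hz
  have t2 : ∀ z ∈ closedBall c δ, ‖deriv (deriv h) z - deriv (deriv h) c‖ ≤ H / s / s / s * δ := by
    intro z hz
    have := (convex_closedBall c δ).norm_image_sub_le_of_norm_deriv_le (f := deriv (deriv h))
      (fun u hu => (hh.deriv.deriv u (mono (by linarith) hu)).differentiableAt)
      (fun u hu => d3 u (mono (by linarith) hu)) (hcs hδ.le) hz
    refine this.trans ?_
    gcongr
    simpa [dist_eq_norm] using hz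
  have t3 : ∀ z ∈ closedBall c δ,
      ‖deriv h z - deriv (deriv h) c * (z - c)‖ ≤ γ / 2 * δ := by
    intro z hz
    have hd : ∀ u ∈ closedBall c δ, HasDerivAt (fun v => deriv h v - deriv (deriv h) c * (v - c))
        (deriv (deriv h) u - deriv (deriv h) c) u := by
      intro u hu
      have a1 := (hh.deriv u (mono (by linarith) hu)).differentiableAt.hasDerivAt
      have a2 := ((hasDerivAt_id u).sub_const c).const_mul (deriv (deriv h) c)
      have a3 := a1.sub a2
      rw [mul_one] at a3
      exact a3
    have := (convex_closedBall c δ).norm_image_sub_le_of_norm_hasDerivWithin_le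
      (fun u hu => (hd u hu).hasDerivWithinAt) t2 (hcs hδ.le) hz
    simp only [h1, sub_self, mul_zero, sub_zero] at this
    refine this.trans ?_
    have hz' : ‖z - c‖ ≤ δ := by simpa [dist_eq_norm] using hz
    have hg : 0 ≤ γ / 2 := (mul_nonneg hM3 hδ.le).trans hδ1
    gcongr
  have t4 : ∀ z ∈ sphere c δ, γ * δ / 2 ≤ ‖deriv h z‖ := by
    intro z hz
    have a := t3 z (sphere_subset_closedBall hz)
    have hz' : ‖z - c‖ = δ := by simpa [dist_eq_norm] using hz
    have b : ‖deriv (deriv h) c * (z - c)‖ ≤ ‖deriv h z‖ + γ / 2 * δ := by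
      have := norm_sub_norm_le (deriv (deriv h) c * (z - c)) (deriv h z)
      rw [norm_sub_rev] at this
      linarith
    rw [norm_mul, hz'] at b
    nlinarith
  have hc' := e1' c (hcs hδ.le)
  rw [h1, zero_sub, norm_neg] at hc'
  have hE : 0 ≤ Q / s := (norm_nonneg _).trans hc'
  set ε := γ * δ / 2 - 2 * (Q / s) with hε
  have t5 : ∀ z ∈ sphere c δ, ε ≤ ‖deriv p z - deriv p c‖ := by
    intro z hz
    have a := t4 z hz
    have b := e1' z (sphere_subset_closedBall hz)
    have e : deriv h z = (deriv h z - deriv p z) + (deriv p z - deriv p c) + deriv p c := by ring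
    have := norm_add₃_le (a := deriv h z - deriv p z) (b := deriv p z - deriv p c) (c := deriv p c)
    rw [← e] at this
    linarith
  have hpd : AnalyticOnNhd ℂ (deriv p) (closedBall c δ) := hp.deriv.mono (mono (by linarith))
  have hdc : DiffContOnCl ℂ (deriv p) (ball c δ) :=
    DifferentiableOn.diffContOnCl_ball (U := closedBall c δ) hpd.differentiableOn subset_rfl
  have hfreq : ∃ᶠ z in nhds c, deriv p z ≠ deriv p c := by
    intro hev
    have hev' : deriv p =ᶠ[nhds c] fun _ => deriv p c := by
      filter_upwards [hev] with z hz
      simpa using hz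
    have heq := hpd.eqOn_of_preconnected_of_eventuallyEq (analyticOnNhd_const)
      (convex_closedBall c δ).isPreconnected (hcs hδ.le) hev'
    have hm : c + δ ∈ sphere c δ := by simp [abs_of_pos hδ]
    have := t5 _ hm
    rw [heq (sphere_subset_closedBall hm)] at this
    simp at this
    linarith
  have hsub := hdc.ball_subset_image_closedBall hδ t5 hfreq
  have hmem : (0 : ℂ) ∈ ball (deriv p c) (ε / 2) := by
    rw [mem_ball, dist_eq_norm, zero_sub, norm_neg]
    linarith
  obtain ⟨w, hw, hw0⟩ := hsub hmem
  exact ⟨w, hw, hw0, t0 w hw⟩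

set_option maxHeartbeats 1000000 in
/-- If `h` is analytic on `𝔻` with coefficients `|h_k| ≤ K e^{βk}`, has a double
zero at `z₀` in the annulus `{β < |z| < e^{−8β}}` with `|h″(z₀)| ≥ γ`, then for
every `m ≥ C = C(γ,K,β)` the derivative of the `m`-th Taylor polynomial `p_m` of `h`
has a root `w` in the annulus `{βe^{−β} < |z| < e^{−7β}}` with
`|h(w)| ≤ C e^{−βm}|w|^m`. -/
theorem stmt_8 (K β γ : ℝ) (hK : 0 < K) (hβ0 : 0 < β) (hβ1 : β < 1) (hγ : 0 < γ) :
    ∃ C : ℝ, ∀ h : ℂ → ℂ, AnalyticOnNhd ℂ h (Metric.ball 0 1) →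
      (∀ k : ℕ, ‖iteratedDeriv k h 0 / (k ! : ℂ)‖ ≤ K * Real.exp (β * k)) →
      ∀ z₀ : ℂ, β < ‖z₀‖ → ‖z₀‖ < Real.exp (-8 * β) →
        h z₀ = 0 → deriv h z₀ = 0 → γ ≤ ‖iteratedDeriv 2 h z₀‖ →
        ∀ m : ℕ, C ≤ m →
          ∃ w : ℂ, β * Real.exp (-β) < ‖w‖ ∧ ‖w‖ < Real.exp (-7 * β) ∧
            deriv (fun z => ∑ k ∈ Finset.range (m + 1),
              (iteratedDeriv k h 0 / (k ! : ℂ)) * z ^ k) w = 0 ∧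
            ‖h w‖ ≤ C * Real.exp (-β * m) * ‖w‖ ^ m := by
  set x := Real.exp β with hx
  have hx1 : 1 < x := Real.one_lt_exp_iff.2 hβ0
  have hx0 : 0 < x := by positivity
  set t := Real.exp (-β) with ht
  have ht0 : 0 < t := Real.exp_pos _
  have ht1 : t < 1 := by rw [ht]; simpa using hβ0
  have hxt : x * t = 1 := by rw [hx, ht, ← Real.exp_add]; simp
  have e8 : Real.exp (-8 * β) = t ^ 8 := by
    rw [ht, ← Real.exp_nat_mul]; congr 1; push_cast; ring
  have e7 : Real.exp (-7 * β) = t ^ 7 := by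
    rw [ht, ← Real.exp_nat_mul]; congr 1; push_cast; ring
  have em : ∀ m : ℕ, Real.exp (-β * m) = t ^ m := by
    intro m; rw [ht, ← Real.exp_nat_mul]; congr 1; ring
  have ek : ∀ m : ℕ, Real.exp (β * m) = x ^ m := by
    intro m; rw [hx, ← Real.exp_nat_mul]; congr 1; ring
  have htm : ∀ m : ℕ, 0 < m → t ^ m ≤ 1 / (β * m) := by
    intro m hm
    have hm' : (0 : ℝ) < m := by exact_mod_cast hm
    have h1 : β * m ≤ x ^ m := by
      rw [← ek]; linarith [Real.add_one_le_exp (β * m)]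
    have h2 : x ^ m * t ^ m = 1 := by rw [← mul_pow, hxt, one_pow]
    rw [le_div_iff₀ (by positivity)]
    calc t ^ m * (β * m) ≤ t ^ m * x ^ m := by gcongr
      _ = 1 := by linarith
  rw [e8, e7]
  simp only [em, ek]
  have ht6 : t ^ 6 < 1 := pow_lt_one₀ ht0.le ht1 (by norm_num)
  obtain ⟨H, hH⟩ : ∃ H, H = K / (1 - t ^ 6) := ⟨_, rfl⟩
  have hH0 : 0 < H := by rw [hH]; exact div_pos hK (by linarith)
  obtain ⟨s, hs⟩ : ∃ s, s = β * (1 - t) / 4 := ⟨_, rfl⟩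
  have hs0 : 0 < s := by
    rw [hs]; exact div_pos (mul_pos hβ0 (by linarith)) (by norm_num)
  obtain ⟨B, hB⟩ : ∃ B, B = 16 * (H / s) / γ := ⟨_, rfl⟩
  have hB0 : 0 < B := by rw [hB]; positivity
  have hc1 : 0 < B / (β * s) := by positivity
  have hc2 : 0 < 2 * (H / s / s / s) * B / (β * γ) := by positivity
  have hc3 : 0 < H / s / s * B * B := by positivity
  refine ⟨1 + B / (β * s) + 2 * (H / s / s / s) * B / (β * γ) + H / s / s * B * B, ?_⟩
  intro h hh hb z₀ hz1 hz2 h0 h1 h2 m hm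
  obtain ⟨r, hr⟩ : ∃ r, r = ‖z₀‖ := ⟨_, rfl⟩
  rw [← hr] at hz1 hz2
  have hr0 : 0 < r := by linarith
  have hm1 : (1 : ℝ) ≤ m := by linarith
  have hm0 : 0 < m := by exact_mod_cast (by linarith : (0 : ℝ) < m)
  have hrx : r * x < t ^ 7 := by
    calc r * x < t ^ 8 * x := by gcongr
      _ = t ^ 7 * (x * t) := by ring
      _ = t ^ 7 := by rw [hxt, mul_one]
  obtain ⟨y, hy⟩ : ∃ y, y = x * (r * x) := ⟨_, rfl⟩
  have hy0 : 0 < y := by rw [hy]; positivity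
  have hyt : y < t ^ 6 := by
    calc y = x * (r * x) := hy
      _ < x * t ^ 7 := by gcongr
      _ = t ^ 6 * (x * t) := by ring
      _ = t ^ 6 := by rw [hxt, mul_one]
  have hrx1 : r * x < 1 := hrx.trans (pow_lt_one₀ ht0.le ht1 (by norm_num))
  have hs4 : 4 * s ≤ r * (1 - t) := by
    rw [hs]; nlinarith
  have hxx : 1 - t ≤ x - 1 := by nlinarith
  have hin : ∀ z ∈ Metric.closedBall z₀ (4 * s), ‖z‖ ≤ r * x := by
    intro z hz
    have a : ‖z - z₀‖ ≤ 4 * s := by simpa [dist_eq_norm] using hz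
    have b := norm_sub_norm_le z z₀
    rw [← hr] at b
    have e : r * (1 - t) ≤ r * (x - 1) := by gcongr
    have e' : r * (x - 1) = r * x - r := by ring
    linarith
  have hU : Metric.closedBall z₀ (4 * s) ⊆ Metric.ball 0 1 := by
    intro z hz
    have := hin z hz
    simpa using lt_of_le_of_lt this hrx1
  have htail : ∀ N : ℕ, ∀ z ∈ Metric.closedBall z₀ (4 * s),
      ‖h z - ∑ k ∈ Finset.range N, (iteratedDeriv k h 0 / (k ! : ℂ)) * z ^ k‖ ≤ H * y ^ N := by
    intro N z hz
    have := aux_tail hK hx0 (by positivity) hrx1 (by rw [← hy]; linarith) hh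
      hb N z (hin z hz)
    rw [← hy] at this
    refine this.trans ?_
    rw [hH]
    have : 0 < 1 - t ^ 6 := by linarith
    gcongr
  have hym : y ^ m ≤ t ^ m := by
    gcongr
    exact hyt.le.trans (pow_le_of_le_one ht0.le ht1.le (by norm_num))
  have hym2 : B * y ^ m ≤ B / (β * m) := by
    calc B * y ^ m ≤ B * (1 / (β * m)) := by gcongr; exact hym.trans (htm m hm0)
      _ = _ := by ring
  have hmpos : (0 : ℝ) < m := by linarith
  have hδs : B * y ^ m ≤ s := by
    refine hym2.trans ?_
    have : B / (β * s) ≤ m := by linarith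
    rw [div_le_iff₀ (by positivity)] at this ⊢
    linarith
  obtain ⟨w, hw, hw0, hwb⟩ := aux_core (h := h)
    (p := fun z => ∑ k ∈ Finset.range (m + 1), (iteratedDeriv k h 0 / (k ! : ℂ)) * z ^ k)
    (c := z₀) (s := s) (H := H) (Q := H * y ^ m) (γ := γ) (δ := B * y ^ m) hs0 (by positivity)
    hδs (hh.mono hU) (fun z _ => by fun_prop)
    (fun z hz => by simpa using htail 0 z hz)
    (fun z hz => (htail (m + 1) z hz).trans (by
      gcongr ?_ * ?_
      exact pow_le_pow_of_le_one hy0.le (by linarith) (by omega)))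
    h0 h1 (by simpa [iteratedDeriv_succ] using h2)
    (by
      have : 2 * (H / s / s / s) * B / (β * γ) ≤ m := by linarith
      rw [div_le_iff₀ (by positivity)] at this
      calc H / s / s / s * (B * y ^ m) ≤ H / s / s / s * (B / (β * m)) := by gcongr
        _ = (2 * (H / s / s / s) * B) / (2 * (β * m)) := by ring
        _ ≤ (m * (β * γ)) / (2 * (β * m)) := by gcongr
        _ = γ / 2 := by field_simp)
    (by
      have e : γ * (B * y ^ m) / 2 = 8 * (H * y ^ m / s) := by
        rw [hB]; field_simp; ring
      have : 0 < H * y ^ m / s := by positivity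
      rw [e]; linarith)
  have hww : ‖w - z₀‖ ≤ s := by
    have : ‖w - z₀‖ ≤ B * y ^ m := by simpa [dist_eq_norm] using hw
    linarith
  have hwlow : r * t ≤ ‖w‖ := by
    have b := norm_sub_norm_le z₀ w
    rw [← hr, norm_sub_rev] at b
    have e : r * (1 - t) = r - r * t := by ring
    linarith
  refine ⟨w, lt_of_lt_of_le (by gcongr) hwlow, lt_of_le_of_lt (hin w ?_) hrx, hw0, ?_⟩
  · rw [Metric.mem_closedBall, dist_eq_norm]; linarith
  have hyy : y ^ m * y ^ m ≤ t ^ m * (r * t) ^ m := by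
    rw [← mul_pow, ← mul_pow]
    refine pow_le_pow_left₀ (by positivity) ?_ m
    have hyt2 : y * t ^ 2 = r := by
      calc y * t ^ 2 = r * (x * t) * (x * t) := by rw [hy]; ring
        _ = r := by rw [hxt]; ring
    calc y * y ≤ y * t ^ 6 := by gcongr
      _ = r * t ^ 4 := by rw [← hyt2]; ring
      _ ≤ r * t ^ 2 := by
        gcongr r * ?_
        exact pow_le_pow_of_le_one ht0.le ht1.le (by norm_num)
      _ = t * (r * t) := by ring
  calc ‖h w‖ ≤ H / s / s * (B * y ^ m) * (B * y ^ m) := hwb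
    _ = H / s / s * B * B * (y ^ m * y ^ m) := by ring
    _ ≤ H / s / s * B * B * (t ^ m * (r * t) ^ m) := by gcongr
    _ ≤ (1 + B / (β * s) + 2 * (H / s / s / s) * B / (β * γ) + H / s / s * B * B)
        * (t ^ m * ‖w‖ ^ m) := by
      gcongr
      linarith
    _ = _ := by ring
end
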